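/- Let K be an algebraically closed field and V a K-vector space of dimension n. Fix integers a, b_1 < b_2, and c_1 < c_2 < c_3 < c_4 < c_5, all strictly between 0 and n, such that a ∉ {1, 2, n−2, n−1}, b_1 ≠ 1, b_2 ≠ n−1, and b_2 ≠ b_1 + 1. Then the GL(V)-action on configurations (A, B_1 ⊆ B_2, C_1 ⊆ C_2 ⊆ C_3 ⊆ C_4 ⊆ C_5) of eight subspaces of V with dim A = a, dim B_i = b_i and dim C_j = c_j has infinitely many orbits. -/

import Mathlib

open Module

namespace OrbAux

variable {K : Type*} [Field K]

def coordSub (K : Type*) [Field K] {m : ℕ} (P : Fin m → Prop) : Submodule K (Fin m → K) where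
  carrier := {v | ∀ i, ¬ P i → v i = 0}
  add_mem' := by
    intro a b ha hb i hi
    simp [ha i hi, hb i hi]
  zero_mem' := by intro i _; rfl
  smul_mem' := by
    intro c x hx i hi
    simp [hx i hi]

theorem mem_coordSub {m : ℕ} {P : Fin m → Prop} {v : Fin m → K} :
    v ∈ coordSub K P ↔ ∀ i, ¬ P i → v i = 0 := Iff.rfl

theorem finrank_coordSub {m : ℕ} (P : Fin m → Prop) [DecidablePred P] :
    finrank K (coordSub K P) = Fintype.card {i // P i} := by
  let e : coordSub K P ≃ₗ[K] ({i // P i} → K) :=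
    { toFun := fun v i => v.1 i.1
      map_add' := fun _ _ => rfl
      map_smul' := fun _ _ => rfl
      invFun := fun w => ⟨fun i => if h : P i then w ⟨i, h⟩ else 0, by
        intro i hi
        simp [hi]⟩
      left_inv := by
        intro v
        ext i
        by_cases h : P i
        · simp [h]
        · simp [h, v.2 i h]
      right_inv := by
        intro w
        ext i
        simp [i.2] }
  rw [e.finrank_eq, finrank_fintype_fun_eq_card]

theorem finrank_coordSub_lt {m k : ℕ} (hk : k ≤ m) :
    finrank K (coordSub K (fun i : Fin m => i.val < k)) = k := by
  rw [finrank_coordSub, Fintype.card_subtype]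
  have : (Finset.univ.filter (fun i : Fin m => i.val < k)).card = min m k := by
    rw [Fin.card_filter_val_lt]
  omega

theorem coordSub_mono {m : ℕ} {P Q : Fin m → Prop} (h : ∀ i, P i → Q i) :
    coordSub K P ≤ coordSub K Q := fun _ hv i hi => hv i (fun hp => hi (h i hp))

def Asub (t : K) : Submodule K (Fin 6 → K) where
  carrier := {v | v 0 = v 3 + v 5 ∧ v 2 = v 1 + v 5 ∧ v 4 = v 1 + t * v 3}
  add_mem' := by
    rintro a b ⟨h1, h2, h3⟩ ⟨h4, h5, h6⟩
    refine ⟨?_, ?_, ?_⟩ <;> simp only [Pi.add_apply, *] <;> ring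
  zero_mem' := by simp
  smul_mem' := by
    rintro c a ⟨h1, h2, h3⟩
    refine ⟨?_, ?_, ?_⟩ <;> simp only [Pi.smul_apply, smul_eq_mul, *] <;> ring

theorem mem_Asub {t : K} {v : Fin 6 → K} :
    v ∈ Asub t ↔ v 0 = v 3 + v 5 ∧ v 2 = v 1 + v 5 ∧ v 4 = v 1 + t * v 3 := Iff.rfl

theorem finrank_Asub (t : K) : finrank K (Asub t) = 3 := by
  let e : Asub t ≃ₗ[K] (Fin 3 → K) :=
    { toFun := fun v => ![v.1 1, v.1 3, v.1 5]
      map_add' := fun _ _ => by ext i; fin_cases i <;> rfl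
      map_smul' := fun _ _ => by ext i; fin_cases i <;> rfl
      invFun := fun w => ⟨![w 1 + w 2, w 0, w 0 + w 2, w 1, w 0 + t * w 1, w 2], by
        simp [mem_Asub]⟩
      left_inv := by
        rintro ⟨v, h1, h2, h3⟩
        ext i
        fin_cases i <;> simp [*]
      right_inv := by
        intro w
        ext i
        fin_cases i <;> simp }
  rw [e.finrank_eq]
  simp

theorem hom_zero {s t : K} (hst : s ≠ t) (f : (Fin 6 → K) →ₗ[K] (Fin 6 → K))
    (hA : ∀ v ∈ Asub s, f v ∈ Asub t)
    (hB1 : ∀ v ∈ coordSub K (fun i : Fin 6 => 4 ≤ i.val), f v ∈ coordSub K (fun i : Fin 6 => 4 ≤ i.val))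
    (hB2 : ∀ v ∈ coordSub K (fun i : Fin 6 => 2 ≤ i.val), f v ∈ coordSub K (fun i : Fin 6 => 2 ≤ i.val))
    (hC : ∀ j : Fin 5, ∀ v ∈ coordSub K (fun i : Fin 6 => i.val < j.val + 1),
      f v ∈ coordSub K (fun i : Fin 6 => i.val < j.val + 1)) :
    f (Pi.single 0 1) = 0 := by
  have hsup : ∀ (P : Fin 6 → Prop) (j : Fin 6), P j →
      (Pi.single j 1 : Fin 6 → K) ∈ coordSub K P := by
    intro P j hj i hi
    have : i ≠ j := fun h => hi (h ▸ hj)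
    simp [this]
  set E : Fin 6 → Fin 6 → K := fun j => f (Pi.single j 1)
  -- lower-triangular entries vanish
  have hup : ∀ i j : Fin 6, j.val < i.val → E j i = 0 := by
    intro i j hij
    have hj : j.val < 5 := by omega
    exact hC ⟨j.val, hj⟩ _ (hsup _ j (by simp)) i (by simp; omega)
  have hb1 : ∀ i j : Fin 6, 4 ≤ j.val → i.val < 4 → E j i = 0 := by
    intro i j hj hi
    exact hB1 _ (hsup _ j hj) i (by omega)
  have hb2 : ∀ i j : Fin 6, 2 ≤ j.val → i.val < 2 → E j i = 0 := by
    intro i j hj hi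
    exact hB2 _ (hsup _ j hj) i (by omega)
  have h1 := hA (Pi.single 1 1 + Pi.single 2 1 + Pi.single 4 1) (by
    simp [mem_Asub])
  have h2 := hA (Pi.single 0 1 + Pi.single 3 1 + s • Pi.single 4 1) (by
    simp [mem_Asub])
  have h3 := hA (Pi.single 0 1 + Pi.single 2 1 + Pi.single 5 1) (by
    simp [mem_Asub])
  simp only [map_add, map_smul] at h1 h2 h3
  change E 1 + E 2 + E 4 ∈ _ at h1
  change E 0 + E 3 + s • E 4 ∈ _ at h2
  change E 0 + E 2 + E 5 ∈ _ at h3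
  change E 0 = 0
  clear_value E
  clear hA hB1 hB2 hC hsup
  rw [mem_Asub] at h1 h2 h3
  simp only [Pi.add_apply, Pi.smul_apply, smul_eq_mul] at h1 h2 h3
  have e10 := hup 1 0 (by decide)
  have e20 := hup 2 0 (by decide)
  have e30 := hup 3 0 (by decide)
  have e40 := hup 4 0 (by decide)
  have e50 := hup 5 0 (by decide)
  have e21 := hup 2 1 (by decide)
  have e31 := hup 3 1 (by decide)
  have e41 := hup 4 1 (by decide)
  have e51 := hup 5 1 (by decide)
  have e32 := hup 3 2 (by decide)
  have e42 := hup 4 2 (by decide)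
  have e52 := hup 5 2 (by decide)
  have e43 := hup 4 3 (by decide)
  have e53 := hup 5 3 (by decide)
  have e54 := hup 5 4 (by decide)
  have f02 := hb2 0 2 (by decide) (by decide)
  have f12 := hb2 1 2 (by decide) (by decide)
  have f03 := hb2 0 3 (by decide) (by decide)
  have f13 := hb2 1 3 (by decide) (by decide)
  have f04 := hb2 0 4 (by decide) (by decide)
  have f14 := hb2 1 4 (by decide) (by decide)
  have f05 := hb2 0 5 (by decide) (by decide)
  have f15 := hb2 1 5 (by decide) (by decide)
  have f24 := hb1 2 4 (by decide) (by decide)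
  have f34 := hb1 3 4 (by decide) (by decide)
  have f25 := hb1 2 5 (by decide) (by decide)
  have f35 := hb1 3 5 (by decide) (by decide)
  clear hup hb1 hb2
  simp only [*, add_zero, zero_add, mul_zero] at h1 h2 h3
  obtain ⟨-, p1, p2⟩ := h1
  obtain ⟨q1, -, q2⟩ := h2
  obtain ⟨r1, r2, -⟩ := h3
  have key : (s - t) * E 0 0 = 0 := by
    have : E 4 4 = E 0 0 := by rw [p2, ← p1, r2, ← r1]
    rw [this, ← q1] at q2
    linear_combination q2
  have e00 : E 0 0 = 0 := (mul_eq_zero.mp key).resolve_left (sub_ne_zero.mpr hst)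
  ext i
  fin_cases i
  exacts [e00, e10, e20, e30, e40, e50]

theorem finrank_prod' {V W : Type*} [AddCommGroup V] [Module K V] [AddCommGroup W] [Module K W]
    [FiniteDimensional K V] [FiniteDimensional K W] (p : Submodule K V) (q : Submodule K W) :
    finrank K (p.prod q) = finrank K p + finrank K q := by
  let e : (p.prod q) ≃ₗ[K] (p × q) :=
    { toFun := fun v => (⟨v.1.1, v.2.1⟩, ⟨v.1.2, v.2.2⟩)
      map_add' := fun _ _ => rfl
      map_smul' := fun _ _ => rfl
      invFun := fun v => ⟨(v.1.1, v.2.1), ⟨v.1.2, v.2.2⟩⟩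
      left_inv := fun _ => rfl
      right_inv := fun _ => rfl }
  rw [e.finrank_eq, finrank_prod]

end OrbAux

open OrbAux

/-- GL(V) has infinitely many orbits on configurations `(A, B₁ ⊆ B₂, C₁ ⊆ ⋯ ⊆ C₅)`
with the dimension restrictions of Claim 4.3. -/
theorem infinitely_many_orbits_one_two_five
    (K : Type*) [Field K] [IsAlgClosed K] (V : Type*) [AddCommGroup V] [Module K V]
    [FiniteDimensional K V] (n a b1 b2 : ℕ) (hn : finrank K V = n)
    (c : Fin 5 → ℕ) (hc : StrictMono c)
    (ha0 : 0 < a) (han : a < n) (hb10 : 0 < b1) (hb12 : b1 < b2) (hb2n : b2 < n)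
    (hc0 : ∀ j, 0 < c j) (hcn : ∀ j, c j < n)
    (ha1 : a ≠ 1) (ha2 : a ≠ 2) (ha3 : a ≠ n - 2) (ha4 : a ≠ n - 1)
    (hb1 : b1 ≠ 1) (hb2 : b2 ≠ n - 1) (hb3 : b2 ≠ b1 + 1) :
    { O : Set (Submodule K V × (Submodule K V × Submodule K V) × (Fin 5 → Submodule K V)) |
        ∃ c' : Submodule K V × (Submodule K V × Submodule K V) × (Fin 5 → Submodule K V),
          (finrank K c'.1 = a ∧
            c'.2.1.1 ≤ c'.2.1.2 ∧ finrank K c'.2.1.1 = b1 ∧ finrank K c'.2.1.2 = b2 ∧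
            Monotone c'.2.2 ∧ (∀ j, finrank K (c'.2.2 j) = c j)) ∧
          O = { d | ∃ g : V ≃ₗ[K] V,
            c'.1.map g.toLinearMap = d.1 ∧
            c'.2.1.1.map g.toLinearMap = d.2.1.1 ∧
            c'.2.1.2.map g.toLinearMap = d.2.1.2 ∧
            ∀ j, (c'.2.2 j).map g.toLinearMap = d.2.2 j } }.Infinite := by
  classical
  have hn6 : 6 ≤ n := by omega
  obtain ⟨m, rfl⟩ : ∃ m, n = m + 6 := ⟨n - 6, by omega⟩
  have hcl : ∀ j : Fin 5, j.val + 1 ≤ c j ∧ c j + 5 ≤ m + 6 + j.val := by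
    have h0 := hc0 0
    have h4 := hcn 4
    have h01 : c 0 < c 1 := hc (by decide)
    have h12 : c 1 < c 2 := hc (by decide)
    have h23 : c 2 < c 3 := hc (by decide)
    have h34 : c 3 < c 4 := hc (by decide)
    intro j
    fin_cases j <;> simp <;> omega
  have hcs : ∀ i j : Fin 5, i ≤ j → c i - (i.val + 1) ≤ c j - (j.val + 1) := by
    have h01 : c 0 < c 1 := hc (by decide)
    have h12 : c 1 < c 2 := hc (by decide)
    have h23 : c 2 < c 3 := hc (by decide)
    have h34 : c 3 < c 4 := hc (by decide)
    intro i j hij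
    fin_cases i <;> fin_cases j <;> simp at hij ⊢ <;> omega
  obtain ⟨e⟩ : Nonempty (V ≃ₗ[K] ((Fin 6 → K) × (Fin m → K))) :=
    ⟨LinearEquiv.ofFinrankEq _ _ (by rw [hn]; simp; omega)⟩
  let F : ℕ → Submodule K (Fin m → K) := fun k => coordSub K (fun i => i.val < k)
  have hF : ∀ k ≤ m, finrank K (F k) = k := fun k hk => finrank_coordSub_lt hk
  let D : Submodule K (Fin 6 → K) → ℕ → Submodule K V :=
    fun p k => (p.prod (F k)).comap e.toLinearMap
  have hD : ∀ p k, k ≤ m → finrank K (D p k) = finrank K p + k := by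
    intro p k hk
    have : D p k = (p.prod (F k)).map e.symm.toLinearMap :=
      Submodule.comap_equiv_eq_map_symm e (p.prod (F k))
    rw [this, LinearEquiv.finrank_map_eq, finrank_prod', hF k hk]
  have hDm : ∀ p q k l, p ≤ q → k ≤ l → D p k ≤ D q l := by
    intro p q k l hpq hkl
    exact Submodule.comap_mono (Submodule.prod_mono hpq
      (coordSub_mono (fun i hi => lt_of_lt_of_le hi hkl)))
  let B1 : Submodule K (Fin 6 → K) := coordSub K (fun i => 4 ≤ i.val)
  let B2 : Submodule K (Fin 6 → K) := coordSub K (fun i => 2 ≤ i.val)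
  let C : Fin 5 → Submodule K (Fin 6 → K) := fun j => coordSub K (fun i => i.val < j.val + 1)
  have hB1r : finrank K B1 = 2 := by
    change finrank K (coordSub K _) = 2
    rw [finrank_coordSub]; decide
  have hB2r : finrank K B2 = 4 := by
    change finrank K (coordSub K _) = 4
    rw [finrank_coordSub]; decide
  have hCr : ∀ j, finrank K (C j) = j.val + 1 := fun j => finrank_coordSub_lt (by omega)
  let X : K → Submodule K V × (Submodule K V × Submodule K V) × (Fin 5 → Submodule K V) :=
    fun t => (D (Asub t) (a - 3), (D B1 (b1 - 2), D B2 (b2 - 4)),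
      fun j => D (C j) (c j - (j.val + 1)))
  let O : K → Set (Submodule K V × (Submodule K V × Submodule K V) × (Fin 5 → Submodule K V)) :=
    fun t => { d | ∃ g : V ≃ₗ[K] V,
            (X t).1.map g.toLinearMap = d.1 ∧
            (X t).2.1.1.map g.toLinearMap = d.2.1.1 ∧
            (X t).2.1.2.map g.toLinearMap = d.2.1.2 ∧
            ∀ j, ((X t).2.2 j).map g.toLinearMap = d.2.2 j }
  suffices key : ∀ S : Set (Set (Submodule K V × (Submodule K V × Submodule K V) ×
      (Fin 5 → Submodule K V))), (∀ t, O t ∈ S) → S.Infinite by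
    refine key _ (fun t => ⟨X t, ⟨?_, ?_, ?_, ?_, ?_, ?_⟩, rfl⟩)
    · change finrank K (D _ _) = _
      rw [hD _ _ (by omega), finrank_Asub]; omega
    · exact hDm _ _ _ _ (coordSub_mono (fun i hi => by omega)) (by omega)
    · change finrank K (D _ _) = _
      rw [hD _ _ (by omega), hB1r]; omega
    · change finrank K (D _ _) = _
      rw [hD _ _ (by omega), hB2r]; omega
    · intro i j hij
      exact hDm _ _ _ _ (coordSub_mono (fun k hk => by
        have : i.val ≤ j.val := hij
        omega)) (hcs i j hij)
    · intro j
      have := hcl j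
      change finrank K (D _ _) = _
      rw [hD _ _ (by omega), hCr]; omega
  intro S hmem hfin
  have := hfin.to_subtype
  have : Infinite K := IsAlgClosed.instInfinite
  obtain ⟨y, hy⟩ := Finite.exists_infinite_fiber (fun t : K => (⟨O t, hmem t⟩ : S))
  obtain ⟨t0, ht0⟩ := (inferInstance : Nonempty ((fun t : K => (⟨O t, hmem t⟩ : S)) ⁻¹' {y}))
  have hO : ∀ t : ((fun t : K => (⟨O t, hmem t⟩ : S)) ⁻¹' {y}), X t0 ∈ O t := by
    intro t
    have h1 : O t = O t0 := by
      have := t.2.trans ht0.symm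
      exact congrArg Subtype.val this
    rw [h1]
    refine ⟨LinearEquiv.refl K V, ?_, ?_, ?_, fun j => ?_⟩ <;> exact Submodule.map_id _
  choose g gA gB1 gB2 gC using hO
  let w : Fin 6 → K := Pi.single 0 1
  -- the composite maps
  let f := fun s t => (LinearMap.fst K (Fin 6 → K) (Fin m → K)) ∘ₗ e.toLinearMap ∘ₗ
    (g t).symm.toLinearMap ∘ₗ (g s).toLinearMap ∘ₗ e.symm.toLinearMap ∘ₗ
      (LinearMap.inl K (Fin 6 → K) (Fin m → K))
  have hf : ∀ s t (p q : Submodule K (Fin 6 → K)) (k : ℕ) (Y : Submodule K V),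
      (D p k).map (g s).toLinearMap = Y → (D q k).map (g t).toLinearMap = Y →
      ∀ v ∈ p, f s t v ∈ q := by
    intro s t p q k Y h1 h2 v hv
    have h3 : e.symm (v, 0) ∈ D p k := by
      change e (e.symm (v, 0)) ∈ p.prod (F k)
      rw [e.apply_symm_apply]
      exact ⟨hv, zero_mem _⟩
    have h4 : g s (e.symm (v, 0)) ∈ (D q k).map (g t).toLinearMap := by
      rw [h2, ← h1]
      exact Submodule.mem_map_of_mem h3
    obtain ⟨z, hz, hz2⟩ := h4
    have h5 : (g t).symm (g s (e.symm (v, 0))) = z := by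
      rw [← hz2]; exact (g t).symm_apply_apply z
    change (e ((g t).symm (g s (e.symm (v, 0))))).1 ∈ q
    rw [h5]
    exact hz.1
  have hf0 : ∀ s t, s ≠ t → f s t w = 0 := by
    intro s t hst
    refine hom_zero (s := s.1) (t := t.1) (fun h => hst (Subtype.ext h)) (f s t)
      (hf s t _ _ _ _ (gA s) (gA t)) (hf s t _ _ _ _ (gB1 s) (gB1 t))
      (hf s t _ _ _ _ (gB2 s) (gB2 t)) (fun j => hf s t _ _ _ _ (gC s j) (gC t j))
  have hf1 : ∀ s, f s s w = w := by
    intro s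
    change (e ((g s).symm (g s (e.symm (w, 0))))).1 = w
    simp
  have hli : LinearIndependent K (fun s => g s (e.symm (w, 0))) := by
    rw [linearIndependent_iff']
    intro S r hr t ht
    have h1 := congrArg (fun x => (e ((g t).symm x)).1) hr
    simp only [map_sum, map_smul, map_zero, Prod.fst_sum, Prod.smul_fst, Prod.fst_zero] at h1
    have h2 : ∀ s ∈ S, r s • (e ((g t).symm (g s (e.symm (w, 0))))).1
        = if s = t then r s • w else 0 := by
      intro s _
      split_ifs with h
      · subst h
        exact congrArg _ (hf1 s)
      · have := hf0 s t h
        change r s • (f s t w) = 0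
        rw [this, smul_zero]
    rw [Finset.sum_congr rfl h2, Finset.sum_ite_eq' S t, if_pos ht] at h1
    have := congrFun h1 0
    simpa [w] using this
  have := hli.finite
  exact hy.not_finite this
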